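/- arXiv:2306.00026 — 3 statements merged into one kernel-verified Lean document; each statement's English description precedes it below -/
import Mathlib

section
/- For any (w̄, q̄) ∈ W × Δ_m, ε_φ(w̄, q̄) ≤ ε_φ̂(w̄, q̄) + 2 max_{i∈[m]} { p_i (R_i(w̄^{(i)}) − R_i*) }. -/
/-- A weighted average over the standard simplex is at most the supremum of the values. -/
theorem sum_mul_le_ciSup_of_mem_stdSimplex {ι : Type*} [Fintype ι] {q : ι → ℝ}
    (hq : q ∈ stdSimplex ℝ ι) (c : ι → ℝ) : ∑ i, q i * c i ≤ ⨆ i, c i := by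
  calc ∑ i, q i * c i ≤ ∑ i, q i * ⨆ j, c j :=
        Finset.sum_le_sum fun i _ => mul_le_mul_of_nonneg_left
          (le_ciSup (Set.finite_range c).bddAbove i) (hq.1 i)
    _ = ⨆ i, c i := by rw [← Finset.sum_mul, hq.2, one_mul]

/-- Lemma on the optimization-error gap between the weighted MERO objective `φ`
and its approximation `φ̂`: for any `(w̄, q̄) ∈ W × Δ_m`,
`ε_φ(w̄, q̄) ≤ ε_φ̂(w̄, q̄) + 2 max_i { p_i (R_i(w̄^{(i)}) − R_i*) }`. -/
theorem optimization_error_approximation_gap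
    {W : Type*} [Nonempty W] (m : ℕ) (hm : 1 ≤ m)
    (R : Fin m → W → ℝ) (p : Fin m → ℝ) (hp : ∀ i, 0 < p i)
    (Rstar : Fin m → ℝ) (wmin : Fin m → W)
    (hRstar : ∀ i, Rstar i = R i (wmin i)) (hRmin : ∀ i, ∀ u : W, Rstar i ≤ R i u)
    (what : Fin m → W)
    (φ φhat : W → (Fin m → ℝ) → ℝ)
    (hφ : ∀ (u : W) (q : Fin m → ℝ), φ u q = ∑ i, q i * p i * (R i u - Rstar i))
    (hφhat : ∀ (u : W) (q : Fin m → ℝ),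
      φhat u q = ∑ i, q i * p i * (R i u - R i (what i)))
    (hattain : ∀ q ∈ stdSimplex ℝ (Fin m), ∃ u : W, ∀ u' : W, φ u q ≤ φ u' q)
    (wbar : W) (qbar : Fin m → ℝ) (hqbar : qbar ∈ stdSimplex ℝ (Fin m)) :
    (⨆ q : stdSimplex ℝ (Fin m), φ wbar q) - (⨅ u : W, φ u qbar)
      ≤ (⨆ q : stdSimplex ℝ (Fin m), φhat wbar q) - (⨅ u : W, φhat u qbar)
        + 2 * ⨆ i : Fin m, p i * (R i (what i) - Rstar i) := by
  set D := ⨆ i : Fin m, p i * (R i (what i) - Rstar i)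
  have hsplit (u : W) (q : Fin m → ℝ) :
      φ u q = φhat u q + ∑ i, q i * (p i * (R i (what i) - Rstar i)) := by
    rw [hφ, hφhat, ← Finset.sum_add_distrib]
    exact Finset.sum_congr rfl fun i _ => by ring
  have hgap_le {q : Fin m → ℝ} (hq : q ∈ stdSimplex ℝ (Fin m)) :
      ∑ i, q i * (p i * (R i (what i) - Rstar i)) ≤ D :=
    sum_mul_le_ciSup_of_mem_stdSimplex hq _
  have hgap_nonneg : 0 ≤ ∑ i, qbar i * (p i * (R i (what i) - Rstar i)) :=
    Finset.sum_nonneg fun i _ => mul_nonneg (hqbar.1 i)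
      (mul_nonneg (hp i).le (sub_nonneg.2 (hRmin i _)))
  have hD : 0 ≤ D := hgap_nonneg.trans (hgap_le hqbar)
  have hbdd : BddAbove (Set.range fun q : stdSimplex ℝ (Fin m) => φhat wbar q) := by
    refine ⟨⨆ i, p i * (R i wbar - R i (what i)), ?_⟩
    rintro _ ⟨q, rfl⟩
    simp only [hφhat, mul_assoc]
    exact sum_mul_le_ciSup_of_mem_stdSimplex q.2 fun i => p i * (R i wbar - R i (what i))
  have hsup : (⨆ q : stdSimplex ℝ (Fin m), φ wbar q)
      ≤ (⨆ q : stdSimplex ℝ (Fin m), φhat wbar q) + D := by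
    have : Nonempty (stdSimplex ℝ (Fin m)) := ⟨⟨qbar, hqbar⟩⟩
    refine ciSup_le fun q => ?_
    rw [hsplit]
    exact add_le_add (le_ciSup hbdd q) (hgap_le q.2)
  have hinf : (⨅ u : W, φhat u qbar) ≤ ⨅ u : W, φ u qbar := by
    obtain ⟨u₀, hu₀⟩ := hattain qbar hqbar
    have hbelow : BddBelow (Set.range fun u : W => φhat u qbar) := by
      refine ⟨φhat u₀ qbar, ?_⟩
      rintro _ ⟨u, rfl⟩
      have := hu₀ u
      rw [hsplit, hsplit] at this
      exact le_of_add_le_add_right this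
    refine le_ciInf fun u => (ciInf_le hbelow u).trans ?_
    rw [hsplit]
    exact le_add_of_nonneg_right hgap_nonneg
  linarith
end

section
/- With p_i = (1/√(n_m) + 1)/(1/√(n_m) + √(n_m/n_i)) for each i ∈ [m], it holds for every i ∈ [m] that (1/p_i) · max_{k∈[m]} (p_k/√(n_k)) ≤ 1/n_m + 1/√(n_i). -/
/-- with the weights `p_i = (1/√n_m + 1)/(1/√n_m + √(n_m/n_i))`,
for every `i`, `(1/p_i) · max_k (p_k/√n_k) ≤ 1/n_m + 1/√n_i`. -/
theorem weighted_mero_weights_bound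
    (m : ℕ) (n : Fin (m + 1) → ℝ) (hnpos : ∀ i, 0 < n i)
    (hnmono : ∀ i j : Fin (m + 1), i ≤ j → n j ≤ n i)
    (p : Fin (m + 1) → ℝ)
    (hp : ∀ i, p i =
      (1 / Real.sqrt (n (Fin.last m)) + 1) /
        (1 / Real.sqrt (n (Fin.last m)) + Real.sqrt (n (Fin.last m) / n i))) :
    ∀ i : Fin (m + 1),
      (1 / p i) * (⨆ k : Fin (m + 1), p k / Real.sqrt (n k)) ≤
        1 / n (Fin.last m) + 1 / Real.sqrt (n i) := by
  intro i
  have hs : 0 < √(n (Fin.last m)) := Real.sqrt_pos.2 (hnpos _)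
  have hr : ∀ k, 0 < √(n k) := fun k => Real.sqrt_pos.2 (hnpos k)
  have hsr : ∀ k, √(n (Fin.last m)) ≤ √(n k) := fun k =>
    Real.sqrt_le_sqrt (hnmono _ _ (Fin.le_last k))
  have hsq : n (Fin.last m) = √(n (Fin.last m)) ^ 2 := (Real.sq_sqrt (hnpos _).le).symm
  have hp' : ∀ k, p k = (1 / √(n (Fin.last m)) + 1) /
      (1 / √(n (Fin.last m)) + √(n (Fin.last m)) / √(n k)) := fun k => by
    rw [hp, Real.sqrt_div (hnpos _).le]
  rw [hsq]
  generalize √(n (Fin.last m)) = s at *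
  have hsup : (⨆ k, p k / √(n k)) ≤ 1 / s := by
    refine ciSup_le fun k => ?_
    have hk := hr k
    have hle := hsr k
    rw [hp' k]
    generalize √(n k) = r at *
    have h : (1 / s + 1) / (1 / s + s / r) / r = (1 + s) / (r + s ^ 2) := by
      field_simp
    rw [h, div_le_div_iff₀ (by positivity) hs]
    nlinarith
  have hri := hr i
  have hpi : 0 ≤ 1 / p i := by rw [hp' i]; positivity
  refine (mul_le_mul_of_nonneg_left hsup hpi).trans ?_
  rw [hp' i]
  generalize √(n i) = r at *
  have h : 1 / ((1 / s + 1) / (1 / s + s / r)) * (1 / s) = (r + s ^ 2) / (s * r * (1 + s)) := by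
    field_simp
  have h' : 1 / s ^ 2 + 1 / r = (r + s ^ 2) / (s * r * s) := by
    field_simp
  rw [h, h']
  gcongr
  linarith
end

section
/- Let η_1, …, η_t > 0 and let (w_j, q_j) ∈ W × Δ_m for j = 1, …, t, and set w̄ = Σ_{j=1}^t η_j w_j / Σ_{k=1}^t η_k and q̄ = Σ_{j=1}^t η_j q_j / Σ_{k=1}^t η_k. Then sup_{q∈Δ_m} φ(w̄, q) − inf_{w∈W} φ(w, q̄) ≤ (Σ_{j=1}^t η_j)^{-1} · sup_{(w,q)∈W×Δ_m} Σ_{j=1}^t η_j [ ⟨Σ_{i=1}^m q_{j,i} ∇R_i(w_j), w_j − w⟩ − Σ_{i=1}^m (R_i(w_j) − r_i)(q_{j,i} − q_i) ]. -/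
/-- First-order condition: a convex function lies above its tangent at a point of
differentiability. -/
theorem ConvexOn.sub_le_fderiv_apply {E : Type*} [NormedAddCommGroup E] [NormedSpace ℝ E]
    {f : E → ℝ} (hf : ConvexOn ℝ Set.univ f) {x : E} (hx : DifferentiableAt ℝ f x) (y : E) :
    f x - f y ≤ fderiv ℝ f x (x - y) := by
  have hg : ConvexOn ℝ Set.univ (f ∘ AffineMap.lineMap (k := ℝ) x y) :=
    hf.comp_affineMap (AffineMap.lineMap x y)
  have hd : HasDerivAt (f ∘ AffineMap.lineMap (k := ℝ) x y) (fderiv ℝ f x (y - x)) 0 := by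
    refine HasFDerivAt.comp_hasDerivAt (0 : ℝ) ?_ AffineMap.hasDerivAt_lineMap
    simpa using hx.hasFDerivAt
  have h := hg.le_slope_of_hasDerivAt (Set.mem_univ _) (Set.mem_univ _) zero_lt_one hd
  simp only [slope_def_field, Function.comp_apply, AffineMap.lineMap_apply_zero,
    AffineMap.lineMap_apply_one, sub_zero, div_one] at h
  rw [← neg_sub y x, map_neg]
  linarith

/-- deterministic error decomposition for weighted-average saddle-point
iterates: with `w̄ = Σ η_j w_j / Σ η_k` and `q̄ = Σ η_j q_j / Σ η_k`,
`sup_q φ(w̄,q) − inf_w φ(w,q̄) ≤ (Ση_j)⁻¹ sup_{(w,q)} Σ_j η_j [⟨Σ_i q_{j,i}∇R_i(w_j), w_j − w⟩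
  − Σ_i (R_i(w_j) − r_i)(q_{j,i} − q_i)]`. -/
theorem saddle_point_error_decomposition
    {E : Type*} [NormedAddCommGroup E] [NormedSpace ℝ E]
    (W : Set E) (hWne : W.Nonempty) (hWcv : Convex ℝ W)
    (m : ℕ) (hm : 1 ≤ m)
    (R : Fin m → E → ℝ)
    (hRcvx : ∀ i, ConvexOn ℝ Set.univ (R i))
    (hRdiff : ∀ i : Fin m, ∀ u ∈ W, DifferentiableAt ℝ (R i) u)
    (r : Fin m → ℝ)
    (φ : E → (Fin m → ℝ) → ℝ)
    (hφ : ∀ (u : E) (q : Fin m → ℝ), φ u q = ∑ i, q i * (R i u - r i))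
    (t : ℕ) (ht : 1 ≤ t)
    (η : ℕ → ℝ) (hη : ∀ j ∈ Finset.Icc 1 t, 0 < η j)
    (w : ℕ → E) (hw : ∀ j ∈ Finset.Icc 1 t, w j ∈ W)
    (q : ℕ → Fin m → ℝ) (hq : ∀ j ∈ Finset.Icc 1 t, q j ∈ stdSimplex ℝ (Fin m))
    (wbar : E)
    (hwbar : wbar = (∑ k ∈ Finset.Icc 1 t, η k)⁻¹ • ∑ j ∈ Finset.Icc 1 t, η j • w j)
    (qbar : Fin m → ℝ)
    (hqbar : ∀ i, qbar i = (∑ k ∈ Finset.Icc 1 t, η k)⁻¹ * ∑ j ∈ Finset.Icc 1 t, η j * q j i)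
    (hbelow : BddBelow (Set.range fun u : W => φ u qbar))
    (habove : BddAbove (Set.range fun x : W × stdSimplex ℝ (Fin m) =>
      ∑ j ∈ Finset.Icc 1 t, η j *
        ((∑ i, q j i • fderiv ℝ (R i) (w j)) (w j - (x.1 : E)) -
          ∑ i, (R i (w j) - r i) * (q j i - (x.2 : Fin m → ℝ) i)))) :
    (⨆ qq : stdSimplex ℝ (Fin m), φ wbar qq) - (⨅ u : W, φ u qbar)
      ≤ (∑ j ∈ Finset.Icc 1 t, η j)⁻¹ *
          ⨆ x : W × stdSimplex ℝ (Fin m),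
            ∑ j ∈ Finset.Icc 1 t, η j *
              ((∑ i, q j i • fderiv ℝ (R i) (w j)) (w j - (x.1 : E)) -
                ∑ i, (R i (w j) - r i) * (q j i - (x.2 : Fin m → ℝ) i)) := by
  set S := ∑ k ∈ Finset.Icc 1 t, η k with hS
  have hSpos : 0 < S := Finset.sum_pos hη (Finset.nonempty_Icc.mpr ht)
  have hWn : Nonempty W := hWne.to_subtype
  have hΔn : Nonempty (stdSimplex ℝ (Fin m)) := ⟨⟨q 1, hq 1 (by simp [ht])⟩⟩
  suffices key : ∀ (qq : stdSimplex ℝ (Fin m)) (u : W), φ wbar qq - φ u qbar ≤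
      S⁻¹ * ∑ j ∈ Finset.Icc 1 t, η j *
        ((∑ i, q j i • fderiv ℝ (R i) (w j)) (w j - (u : E)) -
          ∑ i, (R i (w j) - r i) * (q j i - (qq : Fin m → ℝ) i)) by
    rw [sub_le_iff_le_add]
    refine ciSup_le fun qq => ?_
    rw [← sub_le_iff_le_add']
    refine le_ciInf fun u => ?_
    rw [sub_le_comm]
    exact (key qq u).trans
      (mul_le_mul_of_nonneg_left (le_ciSup habove (u, qq)) (inv_nonneg.mpr hSpos.le))
  intro qq u
  have hR : ∀ i, R i wbar ≤ S⁻¹ * ∑ j ∈ Finset.Icc 1 t, η j * R i (w j) := fun i => by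
    have h := (hRcvx i).map_centerMass_le (t := Finset.Icc 1 t) (w := η) (p := w)
      (fun j hj => (hη j hj).le) hSpos (fun _ _ => Set.mem_univ _)
    simpa [Finset.centerMass, ← hS, ← hwbar] using h
  have hwb : S * φ wbar qq ≤ ∑ j ∈ Finset.Icc 1 t, η j * φ (w j) qq := by
    have hRS : ∀ i, S * (R i wbar - r i) ≤ ∑ j ∈ Finset.Icc 1 t, η j * (R i (w j) - r i) := by
      intro i
      have h := (le_inv_mul_iff₀ hSpos).mp (hR i)
      simp only [mul_sub, Finset.sum_sub_distrib, ← Finset.sum_mul, ← hS]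
      linarith
    calc S * φ wbar qq = ∑ i, (qq : Fin m → ℝ) i * (S * (R i wbar - r i)) := by
          rw [hφ, Finset.mul_sum]
          exact Finset.sum_congr rfl fun i _ => by ring
      _ ≤ ∑ i, (qq : Fin m → ℝ) i * ∑ j ∈ Finset.Icc 1 t, η j * (R i (w j) - r i) :=
          Finset.sum_le_sum fun i _ => mul_le_mul_of_nonneg_left (hRS i) (qq.2.1 i)
      _ = ∑ j ∈ Finset.Icc 1 t, η j * φ (w j) qq := by
          simp only [hφ, Finset.mul_sum]
          rw [Finset.sum_comm]
          exact Finset.sum_congr rfl fun j _ => Finset.sum_congr rfl fun i _ => by ring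
  have hqb : S * φ u qbar = ∑ j ∈ Finset.Icc 1 t, η j * φ u (q j) := by
    have hqS : ∀ i, S * qbar i = ∑ j ∈ Finset.Icc 1 t, η j * q j i := fun i => by
      rw [hqbar, mul_inv_cancel_left₀ hSpos.ne']
    simp only [hφ, Finset.mul_sum, ← mul_assoc, hqS, Finset.sum_mul]
    exact Finset.sum_comm
  rw [le_inv_mul_iff₀ hSpos, mul_sub, hqb]
  refine (sub_le_sub_right hwb _).trans ?_
  rw [← Finset.sum_sub_distrib]
  refine Finset.sum_le_sum fun j hj => ?_
  rw [← mul_sub]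
  refine mul_le_mul_of_nonneg_left ?_ (hη j hj).le
  simp only [hφ, sum_apply, smul_apply, smul_eq_mul,
    ← Finset.sum_sub_distrib]
  refine Finset.sum_le_sum fun i _ => ?_
  have h := mul_le_mul_of_nonneg_left
    ((hRcvx i).sub_le_fderiv_apply (hRdiff i (w j) (hw j hj)) u) ((hq j hj).1 i)
  linarith
end
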